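/- arXiv:1006.2671 — 2 statements merged into one kernel-verified Lean document; each statement's English description precedes it below -/
import Mathlib

section
/- Let T⃗ = (T_1,…,T_d) be a vector homogeneous tree with root tuple t⃗_0 = (T_1(0),…,T_d(0)). For every r ≥ 0 and every partition fan(T⃗) = C_0 ∪ ⋯ ∪ C_r there exist m ∈ {0,…,r} and a vector strong subtree Z⃗ of T⃗ with root tuple t⃗_0 such that every vector fan F⃗ of Z⃗ with F⃗(0) = t⃗_0 belongs to C_m. -/
open Filter

namespace DHLPaper

/-- The tree `b^{<ℕ}` of all finite sequences with values in `{0,…,b−1}`,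
partially ordered by end-extension (`List.IsPrefix`, written `<+:`). -/
def bSeq (b : ℕ) : Set (List ℕ) := {t | ∀ x ∈ t, x < b}

/-- The set of successors of `t` in `T`: `Suc_T(t) = {s ∈ T : t ≤ s}`. -/
def suc (T : Set (List ℕ)) (t : List ℕ) : Set (List ℕ) := {s ∈ T | t <+: s}

/-- `s` is an immediate successor of `t` in `T`. -/
def ImmSuc (T : Set (List ℕ)) (t s : List ℕ) : Prop :=
  t ∈ T ∧ s ∈ T ∧ t <+: s ∧ t ≠ s ∧ ∀ u ∈ T, t <+: u → u <+: s → u = t ∨ u = s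

/-- The `n`-th level of `T`: the nodes of `T` with exactly `n` strict predecessors in `T`. -/
def level (T : Set (List ℕ)) (n : ℕ) : Set (List ℕ) :=
  {t ∈ T | {s ∈ T | s <+: t ∧ s ≠ t}.ncard = n}

/-- `T` has exactly one minimal node. -/
def UniquelyRooted (T : Set (List ℕ)) : Prop := ∃! r, r ∈ level T 0

/-- Every node of `T` has finitely many immediate successors in `T`. -/
def FinitelyBranching (T : Set (List ℕ)) : Prop := ∀ t ∈ T, {s | ImmSuc T t s}.Finite

/-- Every node of `T` has at least one immediate successor in `T`. -/
def Pruned (T : Set (List ℕ)) : Prop := ∀ t ∈ T, ∃ s, ImmSuc T t s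

/-- `S` is a strong subtree of `T` whose level set `L_T(S)` is enumerated by the strictly
increasing map `l`: `S(n) ⊆ T(l n)` for every `n`, `S` is uniquely rooted, and for every
`s ∈ S` and every immediate successor `t` of `s` in `T` there is a unique immediate
successor `s'` of `s` in `S` with `t ≤ s'`. -/
def IsStrongSubtreeWith (T S : Set (List ℕ)) (l : ℕ → ℕ) : Prop :=
  S ⊆ T ∧ UniquelyRooted S ∧ StrictMono l ∧
    (∀ n, level S n ⊆ level T (l n)) ∧
    (∀ s ∈ S, ∀ t, ImmSuc T s t → ∃! s', ImmSuc S s s' ∧ t <+: s')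

/-- `S` is a strong subtree of `T`. -/
def IsStrongSubtree (T S : Set (List ℕ)) : Prop := ∃ l, IsStrongSubtreeWith T S l

/-- A homogeneous tree with branching number `b`: a strong subtree of `b^{<ℕ}`, `b ≥ 2`. -/
def IsHomogeneous (b : ℕ) (T : Set (List ℕ)) : Prop := 2 ≤ b ∧ IsStrongSubtree (bSeq b) T

/-- A vector homogeneous tree: a `d`-tuple of homogeneous trees. -/
def IsVecHomogeneous {d : ℕ} (b : Fin d → ℕ) (T : Fin d → Set (List ℕ)) : Prop :=
  ∀ i, IsHomogeneous (b i) (T i)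

/-- Vector strong subtree: componentwise strong subtrees with a common level set. -/
def IsVecStrongSubtree {d : ℕ} (T S : Fin d → Set (List ℕ)) : Prop :=
  ∃ l, ∀ i, IsStrongSubtreeWith (T i) (S i) l

/-- `⊗T(n) = T_1(n) × ⋯ × T_d(n)`. -/
def vecLevel {d : ℕ} (T : Fin d → Set (List ℕ)) (n : ℕ) : Set (Fin d → List ℕ) :=
  {v | ∀ i, v i ∈ level (T i) n}

/-- The level product `⊗T = ⋃_n ⊗T(n)`. -/
def levelProd {d : ℕ} (T : Fin d → Set (List ℕ)) : Set (Fin d → List ℕ) :=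
  ⋃ n, vecLevel T n

/-- `r` is the root tuple of the vector tree `T`. -/
def IsRoot {d : ℕ} (T : Fin d → Set (List ℕ)) (r : Fin d → List ℕ) : Prop :=
  ∀ i, level (T i) 0 = {r i}

/-- `F` is a vector fan of `T`: `F = (R_1(0) ∪ R_1(1), …, R_d(0) ∪ R_d(1))` for some
vector strong subtree `R` of `T`. -/
def IsVecFan {d : ℕ} (T F : Fin d → Set (List ℕ)) : Prop :=
  ∃ R : Fin d → Set (List ℕ), IsVecStrongSubtree T R ∧
    ∀ i, F i = level (R i) 0 ∪ level (R i) 1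

/-- `fan(T,n)`: the vector fans of `T` with `⊗F(1) ⊆ ⊗T(n)`. -/
def fanAt {d : ℕ} (T : Fin d → Set (List ℕ)) (n : ℕ) : Set (Fin d → Set (List ℕ)) :=
  {F | IsVecFan T F ∧ vecLevel F 1 ⊆ vecLevel T n}

/-- Density of `F ⊆ W(n)` in the `n`-th level of `W`. -/
noncomputable def dens (W : Set (List ℕ)) (n : ℕ) (F : Set (List ℕ)) : ℝ :=
  (F.ncard : ℝ) / ((level W n).ncard : ℝ)

/-- Density of `F ⊆ W(n)` relative to the node `w`. -/
noncomputable def densRel (W : Set (List ℕ)) (n : ℕ) (F : Set (List ℕ)) (w : List ℕ) : ℝ :=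
  ((F ∩ suc W w).ncard : ℝ) / ((level W n ∩ suc W w).ncard : ℝ)

/-- `s = w ⌢_W p`: `s` is the immediate successor of `w` in `W` such that the
concatenation `w ⌢ p` is an initial segment of `s`. -/
def IsConcat (W : Set (List ℕ)) (w : List ℕ) (p : ℕ) (s : List ℕ) : Prop :=
  ImmSuc W w s ∧ w ++ [p] <+: s

/-- The density Halpern–Läuchli statement in dimension `d`. -/
def DHL (d : ℕ) : Prop :=
  ∀ (b : Fin d → ℕ) (T : Fin d → Set (List ℕ)), IsVecHomogeneous b T →
    ∀ D : Set (Fin d → List ℕ), D ⊆ levelProd T →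
      0 < Filter.limsup
          (fun n => ((D ∩ vecLevel T n).ncard : ℝ) / ((vecLevel T n).ncard : ℝ)) atTop →
      ∃ S : Fin d → Set (List ℕ), IsVecStrongSubtree T S ∧ levelProd S ⊆ D

/-- `D : ⊗T → 2^W` is an `ε`-dense level selection along the strictly increasing
sequence `l`: for every `n` and every `t⃗ ∈ ⊗T(n)`, `D(t⃗) ⊆ W(l n)` and
`dens(D(t⃗)) ≥ ε`. -/
def IsDenseLevelSel {d : ℕ} (T : Fin d → Set (List ℕ)) (W : Set (List ℕ)) (l : ℕ → ℕ)
    (ε : ℝ) (D : (Fin d → List ℕ) → Set (List ℕ)) : Prop :=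
  StrictMono l ∧ ∀ n, ∀ v ∈ vecLevel T n, D v ⊆ level W (l n) ∧ ε ≤ dens W (l n) (D v)

/-- The pair `(R, w)` (`R` a vector strong subtree of `T` with root tuple `r0`) is strongly
`θ`-correlated with respect to the dense level selection `D` (with level sequence `l`):
`w ∈ D(r0)` and for every vector fan `F` of `R` with `F(0) = r0` and every `p < b_W`,
`dens(⋂_{r ∈ ⊗F(1)} D(r) | w ⌢_W p) ≥ θ`. -/
def StronglyCorrelated {d : ℕ} (T : Fin d → Set (List ℕ)) (W : Set (List ℕ)) (bW : ℕ)
    (l : ℕ → ℕ) (D : (Fin d → List ℕ) → Set (List ℕ)) (R : Fin d → Set (List ℕ))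
    (r0 : Fin d → List ℕ) (w : List ℕ) (θ : ℝ) : Prop :=
  w ∈ D r0 ∧
    ∀ F : Fin d → Set (List ℕ), IsVecFan R F → IsRoot F r0 →
      ∀ n, vecLevel F 1 ⊆ vecLevel T n →
        ∀ p < bW, ∀ s, IsConcat W w p s →
          θ ≤ densRel W (l n) (⋂ r ∈ vecLevel F 1, D r) s

/-! ### Left variable words: the Carlson–Simpson theorem -/

section Semigroups

theorem exists_forall_exists_mul_mul_eq {M : Type*} [Nonempty M] [Semigroup M]
    [TopologicalSpace M] [CompactSpace M] [T2Space M]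
    (hcont : ∀ r : M, Continuous (· * r)) :
    ∃ w : M, ∀ z, ∃ m, m * (z * w) = w := by
  let S : Set (Set M) := {N | IsClosed N ∧ N.Nonempty ∧ ∀ m, ∀ x ∈ N, m * x ∈ N}
  obtain ⟨N, hN⟩ : ∃ N, Minimal (· ∈ S) N := by
    refine zorn_superset _ fun c hcs hc => ?_
    refine ⟨⋂₀ c, ⟨isClosed_sInter fun t ht => (hcs ht).1, ?_, fun m x hx t ht =>
      (hcs ht).2.2 m x (hx t ht)⟩, fun s hs => Set.sInter_subset_of_mem hs⟩
    obtain rfl | hne := c.eq_empty_or_nonempty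
    · rw [Set.sInter_empty]
      exact Set.univ_nonempty
    · have := hne.coe_sort
      rw [Set.sInter_eq_iInter]
      exact IsCompact.nonempty_iInter_of_directed_nonempty_isCompact_isClosed _
        (DirectedOn.directed_val (IsChain.directedOn hc.symm)) (fun i => (hcs i.prop).2.1)
        (fun i => (hcs i.prop).1.isCompact) (fun i => (hcs i.prop).1)
  obtain ⟨-, ⟨w, hw⟩, hmul⟩ := hN.prop
  refine ⟨w, fun z => ?_⟩
  have hrange : Set.range (· * (z * w)) = N := by
    refine hN.eq_of_subset ⟨(isCompact_range (hcont _)).isClosed, ?_, ?_⟩ ?_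
    · exact ⟨_, w, rfl⟩
    · rintro m _ ⟨x, rfl⟩
      exact ⟨m * x, mul_assoc _ _ _⟩
    · rintro _ ⟨x, rfl⟩
      exact hmul _ _ (hmul _ _ hw)
  rw [← hrange] at hw
  exact hw

attribute [local instance] Ultrafilter.mul Ultrafilter.semigroup

theorem ultrafilter_map_mul {M N : Type*} [Mul M] [Mul N] {f : M → N}
    (hf : ∀ x y, f (x * y) = f x * f y) (U V : Ultrafilter M) :
    (U * V).map f = U.map f * V.map f := by
  apply Ultrafilter.coe_inj.mp
  refine Filter.ext' fun p => ?_
  simp [Ultrafilter.eventually_mul, hf]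

/-- Words form a semigroup under concatenation. -/
abbrev listSemigroup (A : Type*) : Semigroup (List A) where
  mul := (· ++ ·)
  mul_assoc := List.append_assoc

attribute [local instance] listSemigroup

/-- Substitution of the letter `a` for the variable `none`. -/
def substVar {A : Type*} (a : A) (y : List (Option A)) : List A := y.map (·.getD a)

/-- There are an ultrafilter `w` on words and an ultrafilter `y` on left variable words such that
all substitutions `y(a)` satisfy `w * y(a) = w` and `y(a) * y(c) = y(a)`. -/
theorem exists_left_variable_ultrafilter (A : Type*) :
    ∃ (w : Ultrafilter (List A)) (y : Ultrafilter (List (Option A))),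
      (∀ᶠ v : List (Option A) in y, v.head? = some none) ∧
      (∀ a : A, w * y.map (substVar a) = w) ∧
      ∀ a c : A, y.map (substVar a) * y.map (substVar c) = y.map (substVar a) := by
  obtain ⟨w, hw⟩ := exists_forall_exists_mul_mul_eq (M := Ultrafilter (List A))
    Ultrafilter.continuous_mul_left
  let emb : List A → List (Option A) := List.map some
  have hmul (a : A) (u v : List (Option A)) :
      substVar a (u * v) = substVar a u * substVar a v := List.map_append
  have hsubemb (a : A) : (w.map emb).map (substVar a) = w := by
    rw [Ultrafilter.map_map]
    have : substVar a ∘ emb = id := by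
      funext v
      simp [emb, substVar, Function.comp_def]
    rw [this, Ultrafilter.map_id]
  let V : Set (Ultrafilter (List (Option A))) :=
    {U | ∀ᶠ v : List (Option A) in (U : Filter (List (Option A))), v.head? = some none}
  have hV (U : Ultrafilter (List (Option A))) :
      U ∈ V ↔ ∀ᶠ v : List (Option A) in (U : Filter (List (Option A))), v.head? = some none := by
    simp only [V, Set.mem_ofPred_eq]
  obtain ⟨y, ⟨hyV, s, hs⟩, hyy⟩ :
      ∃ y ∈ V ∩ Set.range (· * w.map emb), y * y = y := by
    refine exists_idempotent_in_compact_subsemigroup Ultrafilter.continuous_mul_left _ ?_ ?_ ?_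
    · refine ⟨pure [none] * w.map emb, (hV _).mpr ?_, _, rfl⟩
      rw [Ultrafilter.eventually_mul, Ultrafilter.coe_pure, Filter.eventually_pure]
      exact Filter.Eventually.of_forall fun v => rfl
    · exact ((ultrafilter_isClosed_basic {v : List (Option A) | v.head? = some none}).inter
        (isCompact_range (Ultrafilter.continuous_mul_left _)).isClosed).isCompact
    · rintro x ⟨hx, -⟩ z ⟨-, t, rfl⟩
      refine ⟨(hV _).mpr ?_, x * t, mul_assoc _ _ _⟩
      rw [Ultrafilter.eventually_mul]
      filter_upwards [(hV _).mp hx] with u hu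
      refine Filter.Eventually.of_forall fun v => ?_
      change (u ++ v).head? = some none
      rw [List.head?_append, hu, Option.some_or]
  rw [hV] at hyV
  have hy (a : A) : y.map (substVar a) = s.map (substVar a) * w := by
    rw [← hs]
    exact (ultrafilter_map_mul (hmul a) _ _).trans (by rw [hsubemb])
  have hid (a : A) : y.map (substVar a) * y.map (substVar a) = y.map (substVar a) := by
    rw [← ultrafilter_map_mul (hmul a), hyy]
  have hwy (a : A) : w * y.map (substVar a) = w := by
    obtain ⟨m, hm⟩ := hw (s.map (substVar a))
    rw [← hy] at hm
    rw [← hm, mul_assoc, hid]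
  refine ⟨w, y, hyV, hwy, fun a c => ?_⟩
  rw [hy a, mul_assoc, hwy]

/-- The word `w ⌢ y₀(s₀) ⌢ y₁(s₁) ⌢ ⋯`. -/
def buildWord {A : Type*} (w : List A) (y : ℕ → List (Option A)) (s : List A) : List A :=
  w ++ (s.mapIdx fun k a => substVar a (y k)).flatten

theorem buildWord_nil {A : Type*} (w : List A) (y : ℕ → List (Option A)) :
    buildWord w y [] = w := by
  simp [buildWord]

theorem buildWord_concat {A : Type*} (w : List A) (y : ℕ → List (Option A)) (s : List A) (a : A) :
    buildWord w y (s ++ [a]) = buildWord w y s ++ substVar a (y s.length) := by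
  simp [buildWord]

theorem map_buildWord {A B : Type*} (f : A → B) (w : List A) (y : ℕ → List (Option A))
    (s : List A) :
    (buildWord w y s).map f =
      buildWord (w.map f) (fun k => (y k).map (Option.map f)) (s.map f) := by
  induction s using List.reverseRecOn with
  | nil => simp [buildWord_nil]
  | append_singleton s a ih =>
    simp only [buildWord_concat, List.map_append, ih, List.map_cons, List.map_nil,
      List.length_map, List.append_cancel_left_eq, substVar, List.map_map]
    refine List.map_congr_left fun o _ => ?_
    cases o <;> rfl

theorem length_buildWord {A : Type*} (w : List A) (y : ℕ → List (Option A)) (s : List A) :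
    (buildWord w y s).length = w.length + ∑ k ∈ Finset.range s.length, (y k).length := by
  induction s using List.reverseRecOn with
  | nil => simp [buildWord_nil]
  | append_singleton s a ih =>
    simp [buildWord_concat, ih, Finset.sum_range_succ, substVar, add_assoc]

/-- The Carlson–Simpson theorem. -/
theorem carlson_simpson {A κ : Type*} [Finite A] [Finite κ] (c : List A → κ) :
    ∃ (m : κ) (w : List A) (y : ℕ → List (Option A)),
      (∀ k, (y k).head? = some none) ∧ ∀ s, c (buildWord w y s) = m := by
  classical
  have := Fintype.ofFinite A
  obtain ⟨w, y, hyV, hwy, hyy⟩ := exists_left_variable_ultrafilter A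
  obtain ⟨m, hm⟩ : ∃ m, ∀ᶠ x in w, c x = m := by
    exact (Ultrafilter.eventually_exists_iff (f := w) (P := fun m x => c x = m)).mp
      (Filter.Eventually.of_forall fun x => ⟨c x, rfl⟩)
  let Good (x : List A) : Prop := c x = m ∧ ∀ a, ∀ᶠ v in y, c (x ++ substVar a v) = m
  obtain ⟨x₀, hx₀⟩ : ∃ x₀, Good x₀ := by
    have h : ∀ᶠ x : List A in w, ∀ a, ∀ᶠ v in y, c (x ++ substVar a v) = m := by
      rw [Filter.eventually_all]
      intro a
      rw [← hwy a] at hm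
      exact hm
    exact (hm.and h).exists
  have step (x : List A) (hx : Good x) : ∀ᶠ v in y, ∀ a, Good (x ++ substVar a v) := by
    rw [Filter.eventually_all]
    refine fun a => (hx.2 a).and ?_
    rw [Filter.eventually_all]
    intro e
    have h : ∀ᶠ v : List A in y.map (substVar a), c (x ++ v) = m := hx.2 a
    rw [← hyy a e] at h
    have h' : ∀ᶠ u in y, ∀ᶠ v in y, c (x ++ (substVar a u ++ substVar e v)) = m := h
    simpa only [List.append_assoc] using h'
  have step' (X : Finset (List A)) : ∃ v : List (Option A), v.head? = some none ∧
      ((∀ x ∈ X, Good x) → ∀ x ∈ X, ∀ a, Good (x ++ substVar a v)) := by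
    by_cases hX : ∀ x ∈ X, Good x
    · obtain ⟨v, hv, hv'⟩ := (hyV.and ((Filter.eventually_all_finset X).mpr
        fun x hx => step x (hX x hx))).exists
      exact ⟨v, hv, fun _ => hv'⟩
    · exact ⟨[none], rfl, fun h => absurd h hX⟩
  choose f hf hfX using step'
  let X : ℕ → Finset (List A) := fun n => Nat.rec {x₀}
    (fun _ X => (X ×ˢ Finset.univ).image fun p => p.1 ++ substVar p.2 (f X)) n
  have hX (n : ℕ) : ∀ x ∈ X n, Good x := by
    induction n with
    | zero => simpa [X] using hx₀
    | succ n ih =>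
      intro x hx
      obtain ⟨⟨u, a⟩, hu, rfl⟩ := Finset.mem_image.mp hx
      exact hfX _ ih _ (Finset.mem_product.mp hu).1 a
  refine ⟨m, x₀, fun k => f (X k), fun k => hf _, fun s => ?_⟩
  suffices h : buildWord x₀ (fun k => f (X k)) s ∈ X s.length from (hX _ _ h).1
  induction s using List.reverseRecOn with
  | nil => simp [buildWord_nil, X]
  | append_singleton s a ih =>
    rw [buildWord_concat, List.length_append]
    exact Finset.mem_image.mpr ⟨(_, a), Finset.mem_product.mpr ⟨ih, Finset.mem_univ _⟩, rfl⟩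

end Semigroups

/-! ### Parametrizations of homogeneous trees -/

theorem prefix_trichotomy {A : Type*} (s t : List A) :
    s <+: t ∨ (∃ a, t ++ [a] <+: s) ∨
      ∃ c a e, a ≠ e ∧ c ++ [a] <+: s ∧ c ++ [e] <+: t := by
  induction s generalizing t with
  | nil => exact Or.inl List.nil_prefix
  | cons x s ih =>
    cases t with
    | nil => exact Or.inr (Or.inl ⟨x, by simp⟩)
    | cons z t =>
      by_cases hxz : x = z
      · subst hxz
        rcases ih t with h | ⟨a, h⟩ | ⟨c, a, e, hne, hs, ht⟩
        · exact Or.inl (by simpa using h)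
        · exact Or.inr (Or.inl ⟨a, by simpa using h⟩)
        · exact Or.inr (Or.inr ⟨x :: c, a, e, hne, by simpa using hs, by simpa using ht⟩)
      · exact Or.inr (Or.inr ⟨[], x, z, hxz, by simp, by simp⟩)

theorem eq_of_concat_prefix {A : Type*} {c u : List A} {a e : A} (ha : c ++ [a] <+: u)
    (he : c ++ [e] <+: u) : a = e := by
  have h := List.prefix_of_prefix_length_le ha he (by simp)
  simpa using h.eq_of_length (by simp)

theorem exists_concat_prefix {A : Type*} {s t : List A} (h : s <+: t) (hne : s ≠ t) :
    ∃ a, s ++ [a] <+: t := by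
  obtain ⟨u, rfl⟩ := h
  cases u with
  | nil => simp at hne
  | cons a u => exact ⟨a, u, by simp⟩

theorem prefix_iff_of_concat_prefix {A B : Type*} {e : A → B} (he : Function.Injective e)
    {φ : List A → List B} (h : ∀ s a, φ s ++ [e a] <+: φ (s ++ [a])) (s t : List A) :
    φ s <+: φ t ↔ s <+: t := by
  have mono (s u : List A) : φ s <+: φ (s ++ u) := by
    induction u using List.reverseRecOn with
    | nil => simp
    | append_singleton u a ih =>
      rw [← List.append_assoc]
      exact ih.trans ((List.prefix_append _ _).trans (h _ a))
  have mono' {s t : List A} (hst : s <+: t) : φ s <+: φ t := by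
    obtain ⟨u, rfl⟩ := hst
    exact mono s u
  refine ⟨fun hφ => ?_, mono'⟩
  rcases prefix_trichotomy s t with hst | ⟨a, ha⟩ | ⟨c, a, a', hne, hs, ht⟩
  · exact hst
  · have := (((h t a).trans (mono' ha)).trans hφ).length_le
    simp at this
  · exact absurd (he (eq_of_concat_prefix (((h c a).trans (mono' hs)).trans hφ)
      ((h c a').trans (mono' ht)))) hne

/-- `φ` is an isomorphism of the tree `b^{<ℕ}` onto `T`. -/
structure IsParam {b : ℕ} (φ : List (Fin b) → List ℕ) (T : Set (List ℕ)) : Prop where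
  range_eq : Set.range φ = T
  prefix_iff : ∀ s t, φ s <+: φ t ↔ s <+: t

namespace IsParam

variable {b : ℕ} {φ : List (Fin b) → List ℕ} {T : Set (List ℕ)}

theorem injective (h : IsParam φ T) : Function.Injective φ := fun s t hst =>
  ((h.prefix_iff s t).mp (hst ▸ List.prefix_refl _)).eq_of_length_le
    ((h.prefix_iff t s).mp (hst ▸ List.prefix_refl _)).length_le

theorem mem (h : IsParam φ T) (s : List (Fin b)) : φ s ∈ T := h.range_eq ▸ Set.mem_range_self s

theorem exists_eq (h : IsParam φ T) {t : List ℕ} (ht : t ∈ T) : ∃ s, φ s = t := by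
  rwa [← h.range_eq] at ht

theorem mem_level_iff (h : IsParam φ T) (s : List (Fin b)) (n : ℕ) :
    φ s ∈ level T n ↔ s.length = n := by
  have hpred : {u ∈ T | u <+: φ s ∧ u ≠ φ s} =
      (fun k => φ (s.take k)) '' (Finset.range s.length : Set ℕ) := by
    ext u
    simp only [Set.mem_ofPred_eq, Set.mem_image, Finset.coe_range, Set.mem_Iio]
    constructor
    · rintro ⟨hu, hpre, hne⟩
      obtain ⟨v, rfl⟩ := h.exists_eq hu
      rw [h.prefix_iff] at hpre
      refine ⟨v.length, ?_, by rw [← List.prefix_iff_eq_take.mp hpre]⟩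
      refine lt_of_le_of_ne hpre.length_le fun hl => hne ?_
      rw [hpre.eq_of_length hl]
    · rintro ⟨k, hk, rfl⟩
      refine ⟨h.mem _, (h.prefix_iff _ _).mpr (List.take_prefix _ _), fun heq => ?_⟩
      have := congrArg List.length (h.injective heq)
      simp at this
      omega
  have hinj : Set.InjOn (fun k => φ (s.take k)) (Finset.range s.length : Set ℕ) := by
    intro j hj k hk hjk
    have := congrArg List.length (h.injective hjk)
    simp only [Finset.coe_range, Set.mem_Iio] at hj hk
    simp at this
    omega
  simp only [level, Set.mem_ofPred_eq, h.mem, true_and]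
  rw [hpred, hinj.ncard_image, Set.ncard_coe_finset, Finset.card_range]

theorem level_zero (h : IsParam φ T) : level T 0 = {φ []} := by
  ext t
  constructor
  · intro ht
    obtain ⟨s, rfl⟩ := h.exists_eq ht.1
    rw [h.mem_level_iff, List.length_eq_zero_iff] at ht
    rw [ht]
    rfl
  · rintro rfl
    exact (h.mem_level_iff _ _).mpr rfl

theorem immSuc_iff (h : IsParam φ T) (s : List (Fin b)) (t : List ℕ) :
    ImmSuc T (φ s) t ↔ ∃ a, t = φ (s ++ [a]) := by
  constructor
  · rintro ⟨-, ht, hpre, hne, himm⟩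
    obtain ⟨v, rfl⟩ := h.exists_eq ht
    rw [h.prefix_iff] at hpre
    obtain ⟨a, ha⟩ := exists_concat_prefix hpre (fun hsv => hne (by rw [hsv]))
    refine ⟨a, ?_⟩
    rcases himm _ (h.mem (s ++ [a])) ((h.prefix_iff _ _).mpr (List.prefix_append _ _))
      ((h.prefix_iff _ _).mpr ha) with heq | heq
    · simpa using h.injective heq
    · exact heq.symm
  · rintro ⟨a, rfl⟩
    refine ⟨h.mem _, h.mem _, (h.prefix_iff _ _).mpr (List.prefix_append _ _),
      fun heq => by simpa using h.injective heq, fun u hu hsu hua => ?_⟩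
    obtain ⟨v, rfl⟩ := h.exists_eq hu
    rw [h.prefix_iff] at hsu hua
    rcases List.prefix_concat_iff.mp hua with hv | hv
    · exact Or.inr (by rw [hv])
    · exact Or.inl (by rw [hv.eq_of_length_le hsu.length_le])

end IsParam

theorem immSuc_bSeq {b : ℕ} {s : List ℕ} (hs : s ∈ bSeq b) {p : ℕ} (hp : p < b) :
    ImmSuc (bSeq b) s (s ++ [p]) := by
  refine ⟨hs, ?_, List.prefix_append _ _, by simp, fun u _ hsu hup => ?_⟩
  · intro x hx
    rcases List.mem_append.mp hx with hx | hx
    · exact hs x hx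
    · rwa [List.mem_singleton.mp hx]
  · rcases List.prefix_concat_iff.mp hup with hu | hu
    · exact Or.inr hu
    · exact Or.inl (hu.eq_of_length_le hsu.length_le)

/-- Every node of a tree which is not a root is an immediate successor. -/
theorem exists_immSuc_of_notMem_level_zero {T : Set (List ℕ)} {t : List ℕ} (ht : t ∈ T)
    (h0 : t ∉ level T 0) : ∃ u, ImmSuc T u t := by
  let P : Set (List ℕ) := {s ∈ T | s <+: t ∧ s ≠ t}
  have hmem (s : List ℕ) : s ∈ P ↔ s ∈ T ∧ s <+: t ∧ s ≠ t := by
    simp only [P, Set.mem_ofPred_eq]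
  have hcard : P.ncard ≠ 0 := fun hP => h0 ⟨ht, hP⟩
  obtain ⟨u, hu, hmax⟩ := Set.exists_max_image P List.length
    (Set.finite_of_ncard_ne_zero hcard) (Set.nonempty_of_ncard_ne_zero hcard)
  obtain ⟨huT, hut, hne⟩ := (hmem u).mp hu
  refine ⟨u, huT, ht, hut, hne, fun v hv huv hvt => ?_⟩
  by_cases hvt' : v = t
  · exact Or.inr hvt'
  · exact Or.inl (huv.eq_of_length_le (hmax v ((hmem v).mpr ⟨hv, hvt, hvt'⟩))).symm

theorem IsHomogeneous.exists_isParam {b : ℕ} {T : Set (List ℕ)} (hT : IsHomogeneous b T) :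
    ∃ φ : List (Fin b) → List ℕ, IsParam φ T := by
  obtain ⟨-, l, hsub, ⟨ρ, hρ, hρu⟩, -, -, hsuc⟩ := hT
  have hnext (t : T) (p : Fin b) : ∃ s : T, ImmSuc T t s ∧ t.1 ++ [p.1] <+: s := by
    obtain ⟨s, hs, -⟩ := hsuc t t.2 _ (immSuc_bSeq (hsub t.2) p.2)
    exact ⟨⟨s, hs.1.2.1⟩, hs⟩
  choose next hnextS hnextP using hnext
  let φ : List (Fin b) → T := List.foldl next ⟨ρ, hρ.1⟩
  have hφ (s : List (Fin b)) (p : Fin b) : φ (s ++ [p]) = next (φ s) p := by simp [φ]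
  refine ⟨fun s => φ s, ?_, prefix_iff_of_concat_prefix (e := Fin.val) Fin.val_injective
    fun s p => by rw [hφ]; exact hnextP _ _⟩
  have hsurj (n : ℕ) : ∀ t ∈ T, t.length ≤ n → t ∈ Set.range fun s => (φ s : List ℕ) := by
    induction n with
    | zero =>
      intro t ht hn
      have ht0 : t ∈ level T 0 := by
        by_contra h0
        obtain ⟨u, -, -, hut, hne, -⟩ := exists_immSuc_of_notMem_level_zero ht h0
        exact hne (hut.eq_of_length_le (by omega))
      exact ⟨[], (hρu t ht0).symm⟩
    | succ n ih =>
      intro t ht hn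
      by_cases h0 : t ∈ level T 0
      · exact ⟨[], (hρu t h0).symm⟩
      obtain ⟨u, hu⟩ := exists_immSuc_of_notMem_level_zero ht h0
      obtain ⟨p, hp⟩ := exists_concat_prefix hu.2.2.1 hu.2.2.2.1
      have hlen := hp.length_le
      simp only [List.length_append, List.length_singleton] at hlen
      obtain ⟨s, rfl⟩ := ih u hu.1 (by omega)
      have hpb : p < b := hsub ht p (hp.subset (by simp))
      refine ⟨s ++ [⟨p, hpb⟩], ?_⟩
      simp only [hφ]
      exact (hsuc _ hu.1 _ (immSuc_bSeq (hsub hu.1) hpb)).unique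
        ⟨hnextS _ _, hnextP _ ⟨p, hpb⟩⟩ ⟨hu, hp⟩
  ext t
  exact ⟨by rintro ⟨s, rfl⟩; exact (φ s).2, fun ht => hsurj _ t ht le_rfl⟩

theorem IsParam.comp {b : ℕ} {φ : List (Fin b) → List ℕ} {T : Set (List ℕ)} (h : IsParam φ T)
    {ψ : List (Fin b) → List (Fin b)} (hψ : ∀ s a, ψ s ++ [a] <+: ψ (s ++ [a])) :
    IsParam (φ ∘ ψ) (Set.range (φ ∘ ψ)) where
  range_eq := rfl
  prefix_iff s t := (h.prefix_iff _ _).trans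
    (prefix_iff_of_concat_prefix (e := id) Function.injective_id hψ s t)

theorem IsParam.isStrongSubtreeWith_comp {b : ℕ} {φ : List (Fin b) → List ℕ}
    {T : Set (List ℕ)} (h : IsParam φ T)
    {ψ : List (Fin b) → List (Fin b)} (hψ : ∀ s a, ψ s ++ [a] <+: ψ (s ++ [a]))
    {l : ℕ → ℕ} (hl : StrictMono l) (hlen : ∀ s, (ψ s).length = l s.length) :
    IsStrongSubtreeWith T (Set.range (φ ∘ ψ)) l := by
  have hZ := h.comp hψ
  refine ⟨?_, ⟨φ (ψ []), ?_, ?_⟩, hl, ?_, ?_⟩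
  · rintro _ ⟨s, rfl⟩
    exact h.mem _
  · exact (hZ.mem_level_iff [] 0).mpr rfl
  · intro t ht
    rw [hZ.level_zero] at ht
    exact ht
  · intro n t ht
    obtain ⟨s, rfl⟩ := ht.1
    rw [hZ.mem_level_iff] at ht
    exact (h.mem_level_iff _ _).mpr (by rw [hlen, ht])
  · rintro _ ⟨s, rfl⟩ t ht
    obtain ⟨a, rfl⟩ := (h.immSuc_iff _ _).mp ht
    refine ⟨φ (ψ (s ++ [a])), ⟨(hZ.immSuc_iff _ _).mpr ⟨a, rfl⟩, (h.prefix_iff _ _).mpr (hψ s a)⟩,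
      ?_⟩
    rintro v ⟨hv, hav⟩
    obtain ⟨e, rfl⟩ := (hZ.immSuc_iff _ _).mp hv
    rw [eq_of_concat_prefix ((h.prefix_iff _ _).mp hav) (hψ s e)]
    rfl

theorem IsStrongSubtreeWith.trans {b : ℕ} {χ : List (Fin b) → List ℕ} {T Z R : Set (List ℕ)}
    {l l' : ℕ → ℕ} (hχ : IsParam χ Z) (hZ : IsStrongSubtreeWith T Z l)
    (hR : IsStrongSubtreeWith Z R l') : IsStrongSubtreeWith T R (l ∘ l') := by
  refine ⟨hR.1.trans hZ.1, hR.2.1, hZ.2.2.1.comp hR.2.2.1,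
    fun n => (hR.2.2.2.1 n).trans (hZ.2.2.2.1 _), fun s hs t ht => ?_⟩
  obtain ⟨u, ⟨hu, htu⟩, huniq⟩ := hZ.2.2.2.2 s (hR.1 hs) t ht
  obtain ⟨v, ⟨hv, huv⟩, hvuniq⟩ := hR.2.2.2.2 s hs u hu
  refine ⟨v, ⟨hv, htu.trans huv⟩, ?_⟩
  rintro v' ⟨hv', htv'⟩
  refine hvuniq v' ⟨hv', ?_⟩
  obtain ⟨σ, rfl⟩ := hχ.exists_eq (hR.1 hs)
  obtain ⟨τ, rfl⟩ := hχ.exists_eq (hR.1 hv'.2.1)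
  obtain ⟨a, ha⟩ := exists_concat_prefix ((hχ.prefix_iff _ _).mp hv'.2.2.1)
    (fun heq => hv'.2.2.2.1 (by rw [heq]))
  have hav' := (hχ.prefix_iff _ _).mpr ha
  have himm : ImmSuc Z (χ σ) (χ (σ ++ [a])) := (hχ.immSuc_iff _ _).mpr ⟨a, rfl⟩
  have hta : t <+: χ (σ ++ [a]) := by
    rcases List.prefix_or_prefix_of_prefix htv' hav' with h | h
    · exact h
    · rcases ht.2.2.2.2 _ (hZ.1 himm.2.1) himm.2.2.1 h with heq | heq
      · exact absurd heq.symm himm.2.2.2.1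
      · rw [heq]
  rw [← huniq _ ⟨himm, hta⟩]
  exact hav'

/-! ### Fans with a fixed root -/

theorem immSuc_root_iff_mem_level_one {R : Set (List ℕ)} {ρ v : List ℕ} (hρ : ρ ∈ R)
    (hle : ∀ u ∈ R, ρ <+: u) : ImmSuc R ρ v ↔ v ∈ level R 1 := by
  have hpred (u : List ℕ) : u ∈ {s ∈ R | s <+: v ∧ s ≠ v} ↔ u ∈ R ∧ u <+: v ∧ u ≠ v := by
    simp only [Set.mem_ofPred_eq]
  constructor
  · rintro ⟨-, hv, hρv, hne, himm⟩
    refine ⟨hv, Set.ncard_eq_one.mpr ⟨ρ, ?_⟩⟩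
    ext u
    rw [hpred, Set.mem_singleton_iff]
    constructor
    · rintro ⟨hu, huv, hne'⟩
      exact (himm u hu (hle u hu) huv).resolve_right hne'
    · rintro rfl
      exact ⟨hρ, hρv, hne⟩
  · rintro ⟨hv, hcard⟩
    obtain ⟨z, hz⟩ := Set.ncard_eq_one.mp hcard
    have hz' (u : List ℕ) : u = z ↔ u ∈ R ∧ u <+: v ∧ u ≠ v := by
      rw [← hpred, hz, Set.mem_singleton_iff]
    have hne : ρ ≠ v := by
      rintro rfl
      obtain ⟨hzR, hzv, hne⟩ := (hz' z).mp rfl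
      exact hne (hzv.eq_of_length_le (hle z hzR).length_le)
    have hρz := (hz' ρ).mpr ⟨hρ, hle v hv, hne⟩
    refine ⟨hρ, hv, hle v hv, hne, fun u hu _ huv => ?_⟩
    by_cases huv' : u = v
    · exact Or.inr huv'
    · exact Or.inl (((hz' u).mpr ⟨hu, huv, huv'⟩).trans hρz.symm)

/-- The first level of a strong subtree with the same root contains exactly one node above each
immediate successor of the root. -/
theorem IsParam.exists_level_one_eq {b : ℕ} {χ : List (Fin b) → List ℕ} {Z R : Set (List ℕ)}
    {l : ℕ → ℕ} (hχ : IsParam χ Z) (hR : IsStrongSubtreeWith Z R l)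
    (hroot : level R 0 = {χ []}) :
    ∃ a : Fin b → List (Fin b), (∀ p, (a p).length + 1 = l 1) ∧
      level R 1 = Set.range fun p => χ (p :: a p) := by
  have hρ : χ [] ∈ R := by
    have : χ [] ∈ level R 0 := hroot ▸ rfl
    exact this.1
  have hle : ∀ u ∈ R, χ [] <+: u := fun u hu => by
    obtain ⟨s, rfl⟩ := hχ.exists_eq (hR.1 hu)
    exact (hχ.prefix_iff _ _).mpr List.nil_prefix
  have hsuc (p : Fin b) : ∃! v, ImmSuc R (χ []) v ∧ χ [p] <+: v :=
    hR.2.2.2.2 _ hρ _ ((hχ.immSuc_iff _ _).mpr ⟨p, rfl⟩)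
  have hex (p : Fin b) : ∃ a, ImmSuc R (χ []) (χ (p :: a)) := by
    obtain ⟨v, ⟨hv, hpv⟩, -⟩ := hsuc p
    obtain ⟨τ, rfl⟩ := hχ.exists_eq (hR.1 hv.2.1)
    obtain ⟨a, rfl⟩ := (hχ.prefix_iff _ _).mp hpv
    exact ⟨a, hv⟩
  choose a ha using hex
  have hlev (p : Fin b) : χ (p :: a p) ∈ level R 1 :=
    (immSuc_root_iff_mem_level_one hρ hle).mp (ha p)
  refine ⟨a, fun p => (hχ.mem_level_iff _ _).mp (hR.2.2.2.1 1 (hlev p)), ?_⟩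
  ext v
  constructor
  · intro hv
    have hv' := (immSuc_root_iff_mem_level_one hρ hle).mpr hv
    obtain ⟨τ, rfl⟩ := hχ.exists_eq (hR.1 hv.1)
    cases τ with
    | nil => exact absurd rfl hv'.2.2.2.1
    | cons p τ =>
      refine ⟨p, (hsuc p).unique ⟨ha p, ?_⟩ ⟨hv', ?_⟩⟩ <;>
      exact (hχ.prefix_iff _ _).mpr (by simp)
  · rintro ⟨p, rfl⟩
    exact hlev p

theorem level_zero_eq_of_fan {R : Set (List ℕ)} {t : List ℕ} (hR : UniquelyRooted R)
    (h : level (level R 0 ∪ level R 1) 0 = {t}) : level R 0 = {t} := by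
  obtain ⟨ρ, hρ, huniq⟩ := hR
  have hρF : ρ ∈ level (level R 0 ∪ level R 1) 0 := by
    refine ⟨Or.inl hρ, ?_⟩
    have hfin : {s ∈ R | s <+: ρ ∧ s ≠ ρ}.Finite :=
      (List.finite_toSet ρ.inits).subset fun s hs => (List.mem_inits s ρ).mpr hs.2.1
    have hempty := (Set.ncard_eq_zero hfin).mp hρ.2
    convert Set.ncard_empty (List ℕ)
    refine Set.eq_empty_of_subset_empty fun s hs => ?_
    rw [← hempty]
    exact ⟨hs.1.elim And.left And.left, hs.2⟩
  rw [h] at hρF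
  cases hρF
  ext v
  exact ⟨huniq v, by rintro rfl; exact hρ⟩

theorem exists_map_eval_eq {J : Type*} {β : J → Type*} (n : ℕ) (a : ∀ j, List (β j))
    (ha : ∀ j, (a j).length = n) :
    ∃ α : List (∀ j, β j), ∀ j, α.map (fun f => f j) = a j := by
  refine ⟨List.ofFn fun k : Fin n => fun j => (a j)[k.1]'(by rw [ha]; exact k.2), fun j => ?_⟩
  refine List.ext_getElem (by simp [ha]) fun k h₁ h₂ => by simp

/-- The self-embedding of `b^{<ℕ}` fixing the root and given above its `p`-th immediate successor
by `buildWord (w p) (y p)`. -/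
def buildTree {b : ℕ} (w : Fin b → List (Fin b)) (y : Fin b → ℕ → List (Option (Fin b))) :
    List (Fin b) → List (Fin b)
  | [] => []
  | p :: s => p :: buildWord (w p) (y p) s

theorem buildTree_concat_prefix {b : ℕ} {w : Fin b → List (Fin b)}
    {y : Fin b → ℕ → List (Option (Fin b))} (hy : ∀ p k, (y p k).head? = some none)
    (s : List (Fin b)) (a : Fin b) :
    buildTree w y s ++ [a] <+: buildTree w y (s ++ [a]) := by
  cases s with
  | nil => simp [buildTree]
  | cons p s =>
    obtain ⟨u, hu⟩ : ∃ u, y p s.length = none :: u := by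
      have := hy p s.length
      cases hyp : y p s.length with
      | nil => simp [hyp] at this
      | cons o u => simp_all
    simp [buildTree, buildWord_concat, hu, substVar]

/-- pigeon-hole for vector fans with a fixed root. -/
theorem fan_partition (d : ℕ) (b : Fin d → ℕ) (T : Fin d → Set (List ℕ))
    (hT : IsVecHomogeneous b T) (t0 : Fin d → List ℕ) (ht0 : IsRoot T t0)
    (r : ℕ) (C : Fin (r + 1) → Set (Fin d → Set (List ℕ)))
    (hC : ∀ F : Fin d → Set (List ℕ), IsVecFan T F → ∃ m, F ∈ C m) :
    ∃ (m : Fin (r + 1)) (Z : Fin d → Set (List ℕ)),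
      IsVecStrongSubtree T Z ∧ IsRoot Z t0 ∧
        ∀ F : Fin d → Set (List ℕ), IsVecFan Z F → IsRoot F t0 → F ∈ C m := by
  choose φ hφ using fun i => (hT i).exists_isParam
  have hroot (i : Fin d) : φ i [] = t0 i := by
    have := ht0 i
    rwa [(hφ i).level_zero, Set.singleton_eq_singleton_iff] at this
  -- A word over `A` codes a tuple of words of equal length, one for each immediate successor of
  -- a root, hence a fan with root `t0`.
  let A := ∀ j : Σ i, Fin (b i), Fin (b j.1)
  let fanOf (W : List A) (i : Fin d) : Set (List ℕ) :=
    {t0 i} ∪ Set.range fun p => φ i (p :: W.map fun f => f ⟨i, p⟩)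
  have hcol (W : List A) : ∃ m, (∃ m, fanOf W ∈ C m) → fanOf W ∈ C m := by
    by_cases h : ∃ m, fanOf W ∈ C m
    · exact ⟨h.choose, fun _ => h.choose_spec⟩
    · exact ⟨0, fun h' => absurd h' h⟩
  choose c hc using hcol
  obtain ⟨m, w, y, hy, hm⟩ := carlson_simpson c
  let w' (i : Fin d) (p : Fin (b i)) : List (Fin (b i)) := w.map fun f => f ⟨i, p⟩
  let y' (i : Fin d) (p : Fin (b i)) (k : ℕ) : List (Option (Fin (b i))) :=
    (y k).map (Option.map fun f => f ⟨i, p⟩)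
  let ψ (i : Fin d) : List (Fin (b i)) → List (Fin (b i)) := buildTree (w' i) (y' i)
  have hψ (i : Fin d) (s : List (Fin (b i))) (a : Fin (b i)) :
      ψ i s ++ [a] <+: ψ i (s ++ [a]) :=
    buildTree_concat_prefix (fun p k => by simp [y', hy]) s a
  let l : ℕ → ℕ
    | 0 => 0
    | n + 1 => w.length + ∑ k ∈ Finset.range n, (y k).length + 1
  have hl : StrictMono l := by
    refine strictMono_nat_of_lt_succ fun n => ?_
    cases n with
    | zero => simp [l]
    | succ n =>
      have : 0 < (y n).length := List.length_pos_iff.mpr fun h => by simpa [h] using hy n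
      simp only [l, Finset.sum_range_succ]
      omega
  have hlen (i : Fin d) (s : List (Fin (b i))) : (ψ i s).length = l s.length := by
    cases s with
    | nil => rfl
    | cons p s => simp [ψ, buildTree, length_buildWord, w', y', l]
  have hχ (i : Fin d) : IsParam (φ i ∘ ψ i) (Set.range (φ i ∘ ψ i)) := (hφ i).comp (hψ i)
  have hZ (i : Fin d) : IsStrongSubtreeWith (T i) (Set.range (φ i ∘ ψ i)) l :=
    (hφ i).isStrongSubtreeWith_comp (hψ i) hl (hlen i)
  have hχ0 (i : Fin d) : (φ i ∘ ψ i) [] = t0 i := hroot i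
  refine ⟨m, fun i => Set.range (φ i ∘ ψ i), ⟨l, hZ⟩, fun i => ?_, ?_⟩
  · rw [(hχ i).level_zero, hχ0]
  rintro F ⟨R, ⟨l', hR⟩, hF⟩ hFroot
  have hR0 (i : Fin d) : level (R i) 0 = {t0 i} := by
    refine level_zero_eq_of_fan (hR i).2.1 ?_
    rw [← hF]
    exact hFroot i
  have hFT : IsVecFan T F := ⟨R, ⟨l ∘ l', fun i => (hZ i).trans (hχ i) (hR i)⟩, hF⟩
  choose a ha hR1 using fun i => (hχ i).exists_level_one_eq (hR i) (by rw [hR0, hχ0])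
  obtain ⟨α, hα⟩ := exists_map_eval_eq (J := Σ i, Fin (b i)) (β := fun j => Fin (b j.1))
    (l' 1 - 1) (fun j => a j.1 j.2) (fun j => by have := ha j.1 j.2; omega)
  have ha' (i : Fin d) (p : Fin (b i)) : a i p = α.map fun f => f ⟨i, p⟩ := (hα ⟨i, p⟩).symm
  have hFα : F = fanOf (buildWord w y α) := by
    funext i
    rw [hF, hR0, hR1]
    simp only [fanOf, Function.comp_apply, ψ, buildTree, map_buildWord, ha', w', y']
    rfl
  rw [← hm α, hFα]
  exact hc _ (hFα ▸ hC F hFT)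
end DHLPaper
end

section
/- Let T⃗ = (T_1,…,T_d) be a vector homogeneous tree and, for every n ≥ 1, let 𝔽_n be a subset of fan(T⃗) with the property that for every vector strong subtree S⃗ of T⃗ there exists F⃗ ∈ fan(S⃗) ∩ 𝔽_n with F⃗(0) equal to the root tuple of S⃗. Then for every vector strong subtree R⃗ of T⃗ with root tuple r⃗_0 there exists a vector strong subtree Z⃗ of R⃗ with root tuple r⃗_0 such that for every n ≥ 1 and every F⃗ ∈ fan(Z⃗,n) with F⃗(0) = r⃗_0 we have F⃗ ∈ 𝔽_n. -/
open Filter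

namespace DHLPaper

section CarlsonSimpson

attribute [local instance] Ultrafilter.mul Ultrafilter.semigroup

/-- A nonempty compact right-topological semigroup has a closed left ideal all of whose
idempotents are right identities of it (namely, any minimal closed left ideal). -/
theorem exists_minimal_left_ideal {M : Type*} [Nonempty M] [Semigroup M] [TopologicalSpace M]
    [CompactSpace M] [T2Space M] (hc : ∀ r : M, Continuous (· * r)) :
    ∃ I : Set M, IsClosed I ∧ I.Nonempty ∧ (∀ x, ∀ y ∈ I, x * y ∈ I) ∧
      ∀ e ∈ I, e * e = e → ∀ x ∈ I, x * e = x := by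
  let S : Set (Set M) := {N | IsClosed N ∧ N.Nonempty ∧ ∀ x, ∀ y ∈ N, x * y ∈ N}
  obtain ⟨N, -, hN⟩ : ∃ N, N ⊆ Set.univ ∧ Minimal (· ∈ S) N := by
    refine zorn_superset_nonempty S (fun c hcS hch hne => ?_) Set.univ
      ⟨isClosed_univ, Set.univ_nonempty, fun _ _ _ => Set.mem_univ _⟩
    refine ⟨⋂₀ c, ⟨isClosed_sInter fun t ht => (hcS ht).1, ?_, fun x y hy t ht =>
      (hcS ht).2.2 x y (hy t ht)⟩, fun s hs => Set.sInter_subset_of_mem hs⟩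
    have := hne.coe_sort
    rw [Set.sInter_eq_iInter]
    exact IsCompact.nonempty_iInter_of_directed_nonempty_isCompact_isClosed _
      (DirectedOn.directed_val (IsChain.directedOn hch.symm)) (fun i => (hcS i.2).2.1)
      (fun i => (hcS i.2).1.isCompact) (fun i => (hcS i.2).1)
  obtain ⟨hcl, hne, hmul⟩ := hN.prop
  refine ⟨N, hcl, hne, hmul, fun e he hee x hx => ?_⟩
  have hrange : Set.range (· * e) = N := by
    apply hN.eq_of_subset
    · refine ⟨(isCompact_range (hc e)).isClosed, ⟨_, e, rfl⟩, ?_⟩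
      rintro y _ ⟨z, rfl⟩
      exact ⟨y * z, mul_assoc _ _ _⟩
    · rintro _ ⟨z, rfl⟩
      exact hmul _ _ he
  rw [← hrange] at hx
  obtain ⟨z, rfl⟩ := hx
  simp only [mul_assoc, hee]

theorem continuous_ultrafilter_map {α β : Type*} (f : α → β) :
    Continuous (Ultrafilter.map f) :=
  ultrafilterBasis_is_basis.continuous_iff.2 <| Set.forall_mem_range.mpr fun s ↦
    ultrafilter_isOpen_basic (f ⁻¹' s)

/-- If the homomorphisms `T i : N → M` can simultaneously be pushed into any left ideal of `M`
along the subsemigroup `D` (via `f`), then some ultrafilter `q` containing `D` satisfies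
`T i q * T j q = T i q` for all `i`, `j`. -/
theorem exists_ultrafilter_map_mul_map {M N ι : Type*} [Nonempty M] [Semigroup M] [Semigroup N]
    (T : ι → N → M) (hT : ∀ i x y, T i (x * y) = T i x * T i y)
    (D : Set N) (hD : ∀ x ∈ D, ∀ y ∈ D, x * y ∈ D)
    (f : M → N) (hf : ∀ m, f m ∈ D) (s : ι → M) (hfs : ∀ i m, T i (f m) = s i * m) :
    ∃ q : Ultrafilter N, D ∈ q ∧ ∀ i j (P : M → Prop), (∀ᶠ x in (q : Filter N), P (T i x)) →
      ∀ᶠ x in (q : Filter N), ∀ᶠ y in (q : Filter N), P (T i x * T j y) := by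
  obtain ⟨I, hIc, ⟨p, hp⟩, hI, hIe⟩ :=
    exists_minimal_left_ideal (M := Ultrafilter M) Ultrafilter.continuous_mul_left
  have hmap : ∀ i (u v : Ultrafilter N), (u * v).map (T i) = u.map (T i) * v.map (T i) := by
    intro i u v
    refine Ultrafilter.coe_inj.mp (Filter.ext' fun P => ?_)
    change (∀ᶠ x in (u : Filter N), ∀ᶠ y in (v : Filter N), P (T i (x * y))) ↔
      ∀ᶠ x in (u : Filter N), ∀ᶠ y in (v : Filter N), P (T i x * T i y)
    simp only [hT]
  let J : Set (Ultrafilter N) := {q | D ∈ q} ∩ ⋂ i, Ultrafilter.map (T i) ⁻¹' I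
  have hJc : IsClosed J := (ultrafilter_isClosed_basic D).inter
    (isClosed_iInter fun i => hIc.preimage (continuous_ultrafilter_map _))
  have hJne : J.Nonempty := by
    refine ⟨p.map f, ?_, Set.mem_iInter.2 fun i => ?_⟩
    · exact Filter.Eventually.of_forall (f := (p : Filter M)) hf
    · have : (p.map f).map (T i) = (pure (s i) : Ultrafilter M) * p := by
        refine Ultrafilter.coe_inj.mp (Filter.ext' fun P => ?_)
        change (∀ᶠ x in (p : Filter M), P (T i (f x))) ↔ ∀ᶠ x in (p : Filter M), P (s i * x)
        simp only [hfs]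
      rw [Set.mem_preimage, this]
      exact hI _ _ hp
  have hJm : ∀ᵉ (x ∈ J) (y ∈ J), x * y ∈ J := by
    rintro x ⟨hx, -⟩ y ⟨hy, hy'⟩
    refine ⟨?_, Set.mem_iInter.2 fun i => ?_⟩
    · change ∀ᶠ a in (x : Filter N), ∀ᶠ b in (y : Filter N), a * b ∈ D
      filter_upwards [hx] with a ha
      filter_upwards [hy] with b hb using hD a ha b hb
    · rw [Set.mem_preimage, hmap]
      exact hI _ _ (Set.mem_iInter.1 hy' i)
  obtain ⟨q, ⟨hqD, hqI⟩, hqq⟩ := exists_idempotent_in_compact_subsemigroup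
    Ultrafilter.continuous_mul_left J hJne hJc.isCompact hJm
  refine ⟨q, hqD, fun i j P hP => ?_⟩
  have hij := hIe (q.map (T j)) (Set.mem_iInter.1 hqI j) (by rw [← hmap, hqq])
    (q.map (T i)) (Set.mem_iInter.1 hqI i)
  have hP' : ∀ᶠ x in (q.map (T i) : Filter M), P x := hP
  rw [← hij] at hP'
  exact hP'

/-- Substitution of the letter `a` for the variable `none` in a word with variable. -/
def subst {A : Type*} (a : A) (v : List (Option A)) : List A := v.map (·.getD a)

/-- An ultrafilter on left variable words (words starting with the variable) witnessing the
Carlson–Simpson theorem. -/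
theorem exists_leftVariable_ultrafilter (A : Type*) :
    ∃ q : Ultrafilter (List (Option A)),
      (∀ᶠ v in (q : Filter (List (Option A))), v.head? = some none) ∧
      ∀ a a' (P : List A → Prop), (∀ᶠ v in (q : Filter (List (Option A))), P (subst a v)) →
        ∀ᶠ v in (q : Filter (List (Option A))), ∀ᶠ v' in (q : Filter (List (Option A))),
          P (subst a v ++ subst a' v') := by
  have happend : ∀ x y : List (Option A), x.head? = some none → (x ++ y).head? = some none := by
    intro x y hx
    cases x <;> simp_all
  have hsubst : ∀ (a : A) (m : List A), subst a (none :: m.map some) = a :: m := by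
    intro a m
    simp [subst, Function.comp_def]
  exact exists_ultrafilter_map_mul_map (M := FreeMonoid A) (N := FreeMonoid (Option A))
    (fun a => subst a) (fun a x y => List.map_append) {v | List.head? v = some none}
    (fun x hx y _ => happend x y hx) (fun m => none :: List.map some m) (fun m => rfl)
    (fun a => [a]) hsubst

end CarlsonSimpson

/-- `g` is the canonical isomorphism of `b^{<ℕ}` onto a strong subtree of `b^{<ℕ}` with level
set enumerated by `l`. -/
structure IsStrongEmb {b : ℕ} (g : List (Fin b) → List (Fin b)) (l : ℕ → ℕ) : Prop where
  length_eq : ∀ u, (g u).length = l u.length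
  append_prefix : ∀ u a, g u ++ [a] <+: g (u ++ [a])

/-- The concatenation of the words obtained by substituting the letters of `u` into the variable
words `V n`, `V (n + 1)`, …. -/
def substAll {A : Type*} (V : ℕ → List (Option A)) : ℕ → List A → List A
  | _, [] => []
  | n, a :: u => subst a (V n) ++ substAll V (n + 1) u

section SubstAll

variable {A : Type*} (V : ℕ → List (Option A))

theorem substAll_concat (n : ℕ) (u : List A) (a : A) :
    substAll V n (u ++ [a]) = substAll V n u ++ subst a (V (n + u.length)) := by
  induction u generalizing n with
  | nil => simp [substAll]
  | cons c u ih => simp [substAll, ih, Nat.add_assoc, Nat.add_comm 1]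

theorem length_substAll (u : List A) :
    (substAll V 0 u).length = ∑ j ∈ Finset.range u.length, (V j).length := by
  induction u using List.reverseRecOn with
  | nil => simp [substAll]
  | append_singleton u a ih => simp [substAll_concat, ih, Finset.sum_range_succ, subst]

theorem map_substAll {B : Type*} (f : A → B) (n : ℕ) (u : List A) :
    (substAll V n u).map f = substAll (fun n => (V n).map (Option.map f)) n (u.map f) := by
  induction u generalizing n with
  | nil => simp [substAll]
  | cons c u ih =>
    simp only [substAll, List.map_append, ih, List.map_cons, subst, List.map_map]
    congr 2
    funext o
    cases o <;> rfl

theorem isStrongEmb_substAll {b : ℕ} (w : List (Fin b)) (V : ℕ → List (Option (Fin b)))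
    (hV : ∀ n, (V n).head? = some none) :
    IsStrongEmb (fun u => w ++ substAll V 0 u)
      (fun n => w.length + ∑ j ∈ Finset.range n, (V j).length) where
  length_eq u := by simp [length_substAll]
  append_prefix u a := by
    obtain ⟨v, hv⟩ : ∃ v, V u.length = none :: v := by
      have := hV u.length
      cases h : V u.length <;> simp_all
    rw [substAll_concat, ← List.append_assoc, Nat.zero_add, hv]
    simp [subst]

theorem exists_substAll_forall [Finite A] (q : Ultrafilter (List (Option A)))
    (hq : ∀ᶠ v in (q : Filter (List (Option A))), v.head? = some none)
    (P : ℕ → List A → Prop) (w : List A) (hw : P 0 w)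
    (hP : ∀ n w, P n w → ∀ a, ∀ᶠ v in (q : Filter (List (Option A))), P (n + 1) (w ++ subst a v)) :
    ∃ V : ℕ → List (Option A), (∀ n, (V n).head? = some none) ∧
      ∀ u, P u.length (w ++ substAll V 0 u) := by
  have hstep : ∀ n (X : Set (List A)), ∃ v : List (Option A), v.head? = some none ∧
      (X.Finite → (∀ w ∈ X, P n w) → ∀ w ∈ X, ∀ a, P (n + 1) (w ++ subst a v)) := by
    intro n X
    by_cases hX : X.Finite ∧ ∀ w ∈ X, P n w
    · have h := hq.and ((Filter.eventually_all_finite hX.1).2 fun w hw =>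
        Filter.eventually_all.2 fun a => hP n w (hX.2 w hw) a)
      obtain ⟨v, hv, hv'⟩ := h.exists
      exact ⟨v, hv, fun _ _ => hv'⟩
    · exact ⟨[none], rfl, fun h h' => (hX ⟨h, h'⟩).elim⟩
  choose v hv hvP using hstep
  let X : ℕ → Set (List A) := fun n => Nat.rec {w}
    (fun n X => Set.image2 (fun a w => w ++ subst a (v n X)) Set.univ X) n
  have hX : ∀ n, (X n).Finite ∧ ∀ w ∈ X n, P n w := by
    intro n
    induction n with
    | zero => exact ⟨Set.finite_singleton w, fun w' hw' => by rwa [Set.mem_singleton_iff.1 hw']⟩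
    | succ n ih =>
      refine ⟨Set.Finite.image2 _ Set.finite_univ ih.1, ?_⟩
      rintro _ ⟨a, -, w', hw', rfl⟩
      exact hvP n (X n) ih.1 ih.2 w' hw' a
  have hmem : ∀ u : List A, w ++ substAll (fun n => v n (X n)) 0 u ∈ X u.length := by
    intro u
    induction u using List.reverseRecOn with
    | nil => simp [substAll, X]
    | append_singleton u a ih =>
      rw [substAll_concat, List.length_append, ← List.append_assoc, Nat.zero_add]
      exact ⟨a, Set.mem_univ a, _, ih, rfl⟩
  exact ⟨fun n => v n (X n), fun n => hv _ _, fun u => (hX _).2 _ (hmem u)⟩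

end SubstAll

/-- Tuples of words of the same length are words over the product alphabet. -/
theorem exists_map_eval_eq_s3 {K : Type*} {B : K → Type*} {n : ℕ} (v : ∀ k, List (B k))
    (hv : ∀ k, (v k).length = n) :
    ∃ u : List (∀ k, B k), u.length = n ∧ ∀ k, u.map (fun a => a k) = v k := by
  refine ⟨List.ofFn fun (j : Fin n) k => (v k)[j.1]'(by rw [hv]; exact j.2), by simp, fun k => ?_⟩
  apply List.ext_getElem <;> simp [hv]

/-- Projection to the coordinates of `substAll` over a product alphabet. -/
theorem exists_isStrongEmb_of_substAll {K : Type*} {B : K → ℕ} (w : List (∀ k, Fin (B k)))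
    (V : ℕ → List (Option (∀ k, Fin (B k)))) (hV : ∀ n, (V n).head? = some none) :
    ∃ (η : ∀ k, List (Fin (B k)) → List (Fin (B k))) (l : ℕ → ℕ), (∀ k, IsStrongEmb (η k) l) ∧
      ∀ u k, η k (u.map fun a => a k) = (w ++ substAll V 0 u).map fun a => a k := by
  refine ⟨fun k u => w.map (fun a => a k) ++
    substAll (fun n => (V n).map (Option.map fun a => a k)) 0 u,
    fun n => w.length + ∑ j ∈ Finset.range n, (V j).length, fun k => ?_, fun u k => ?_⟩
  · simpa using isStrongEmb_substAll (w.map fun a => a k)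
      (fun n => (V n).map (Option.map fun a => a k)) (fun n => by simp [hV])
  · rw [List.map_append, map_substAll]

/-- A form of the Halpern–Läuchli theorem with fusion: if each `𝒢 n` meets every vector strong
subtree of `∏ k, (B k)^{<ℕ}` then some vector strong subtree has its `n`-th level product
inside `𝒢 n`, for every `n`. -/
theorem exists_isStrongEmb_mem {K : Type*} [Finite K] (B : K → ℕ) (hB : ∀ k, 0 < B k)
    (𝒢 : ℕ → Set (∀ k, List (Fin (B k))))
    (H : ∀ n (η : ∀ k, List (Fin (B k)) → List (Fin (B k))) (l : ℕ → ℕ),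
      (∀ k, IsStrongEmb (η k) l) →
      ∃ (m : ℕ) (v : ∀ k, List (Fin (B k))), (∀ k, (v k).length = m) ∧
        (fun k => η k (v k)) ∈ 𝒢 n) :
    ∃ (η : ∀ k, List (Fin (B k)) → List (Fin (B k))) (l : ℕ → ℕ), (∀ k, IsStrongEmb (η k) l) ∧
      ∀ n (v : ∀ k, List (Fin (B k))), (∀ k, (v k).length = n) → (fun k => η k (v k)) ∈ 𝒢 n := by
  let A := ∀ k, Fin (B k)
  let C : ℕ → List A → Prop := fun n w => (fun k => w.map fun a => a k) ∈ 𝒢 n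
  obtain ⟨q, hq, hqq⟩ := exists_leftVariable_ultrafilter A
  have key : ∀ n w a, ∀ᶠ v in (q : Filter (List (Option A))), C n (w ++ subst a v) := by
    intro n w a
    by_contra hcon
    rw [← Ultrafilter.eventually_not] at hcon
    have hcon' : ∀ᶠ v in (q : Filter (List (Option A))), ∀ a',
        ∀ᶠ v' in (q : Filter (List (Option A))), ¬ C n (w ++ subst a v ++ subst a' v') :=
      Filter.eventually_all.2 fun a' => by
        simpa only [List.append_assoc] using hqq a a' (fun x => ¬ C n (w ++ x)) hcon
    obtain ⟨v₀, hv₀⟩ := (hcon.and hcon').exists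
    obtain ⟨V, hV, hVP⟩ := exists_substAll_forall q hq
      (fun _ w => ¬ C n w ∧ ∀ a', ∀ᶠ v' in (q : Filter (List (Option A))), ¬ C n (w ++ subst a' v'))
      (w ++ subst a v₀) hv₀ (by
        rintro _ w ⟨-, hw⟩ a
        refine (hw a).and (Filter.eventually_all.2 fun a' => ?_)
        simpa only [List.append_assoc] using hqq a a' (fun x => ¬ C n (w ++ x)) (hw a))
    obtain ⟨η, l, hη, hηV⟩ := exists_isStrongEmb_of_substAll _ V hV
    obtain ⟨m, v, hvm, hv⟩ := H n η l hη
    obtain ⟨u, -, hu⟩ := exists_map_eval_eq_s3 v hvm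
    refine (hVP u).1 ?_
    convert hv using 1
    funext k
    rw [← hu, hηV]
  let a₀ : A := fun k => ⟨0, hB k⟩
  obtain ⟨v₀, hv₀⟩ := (key 0 [] a₀).exists
  obtain ⟨V, hV, hVP⟩ := exists_substAll_forall q hq C _ hv₀ (fun n w _ a => key (n + 1) w a)
  obtain ⟨η, l, hη, hηV⟩ := exists_isStrongEmb_of_substAll _ V hV
  refine ⟨η, l, hη, fun n v hv => ?_⟩
  obtain ⟨u, hun, hu⟩ := exists_map_eval_eq_s3 v hv
  have hu𝒢 := hVP u
  rw [hun] at hu𝒢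
  convert hu𝒢 using 1
  funext k
  rw [← hu, hηV]

section Levels

theorem finite_setOf_prefix {α : Type*} (u : List α) : {s | s <+: u}.Finite := by
  refine (List.finite_toSet u.inits).subset fun s hs => ?_
  simpa using hs

theorem ncard_strict_prefix {α : Type*} (u : List α) :
    {s | s <+: u ∧ s ≠ u}.ncard = u.length := by
  have : {s | s <+: u ∧ s ≠ u} = (fun n => u.take n) '' Set.Iio u.length := by
    ext s
    simp only [Set.mem_ofPred_eq, Set.mem_image, Set.mem_Iio]
    constructor
    · rintro ⟨hs, hne⟩
      refine ⟨s.length, lt_of_le_of_ne hs.length_le fun h => hne (hs.eq_of_length h), ?_⟩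
      exact (List.prefix_iff_eq_take.1 hs).symm
    · rintro ⟨n, hn, rfl⟩
      refine ⟨List.take_prefix n u, fun h => ?_⟩
      have := congrArg List.length h
      rw [List.length_take] at this
      omega
  rw [this, Set.InjOn.ncard_image]
  · simp
  · intro m hm n hn h
    have := congrArg List.length h
    simp only [List.length_take, Set.mem_Iio] at this hm hn
    omega

variable {b : ℕ} {G : List (Fin b) → List ℕ}

theorem injective_of_prefix_iff (hG : ∀ u v, G u <+: G v ↔ u <+: v) :
    Function.Injective G := fun u v h => by
  have h₁ := (hG u v).1 (h ▸ List.prefix_rfl)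
  have h₂ := (hG v u).1 (h ▸ List.prefix_rfl)
  exact h₁.eq_of_length_le h₂.length_le

theorem level_image (hG : ∀ u v, G u <+: G v ↔ u <+: v)
    {D : Set (List (Fin b))} (hD : ∀ u ∈ D, ∀ v, v <+: u → v ∈ D) (n : ℕ) :
    level (G '' D) n = G '' {u ∈ D | u.length = n} := by
  have hinj := injective_of_prefix_iff hG
  have hcard : ∀ u ∈ D, {s ∈ G '' D | s <+: G u ∧ s ≠ G u}.ncard = u.length := by
    intro u hu
    rw [← ncard_strict_prefix u, ← Set.ncard_image_of_injective _ hinj]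
    congr 1
    ext s
    constructor
    · rintro ⟨⟨v, hv, rfl⟩, h, hne⟩
      exact ⟨v, ⟨(hG v u).1 h, fun h => hne (h ▸ rfl)⟩, rfl⟩
    · rintro ⟨v, ⟨h, hne⟩, rfl⟩
      exact ⟨⟨v, hD u hu v h, rfl⟩, (hG v u).2 h, fun h => hne (hinj h)⟩
  ext s
  constructor
  · rintro ⟨⟨u, hu, rfl⟩, h⟩
    exact ⟨u, ⟨hu, by rw [← h, hcard u hu]⟩, rfl⟩
  · rintro ⟨u, ⟨hu, rfl⟩, rfl⟩
    exact ⟨⟨u, hu, rfl⟩, hcard u hu⟩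

theorem level_range (hG : ∀ u v, G u <+: G v ↔ u <+: v) (n : ℕ) :
    level (Set.range G) n = G '' {u | u.length = n} := by
  rw [← Set.image_univ, level_image hG (fun _ _ _ _ => Set.mem_univ _)]
  simp

theorem immSuc_range_iff (hG : ∀ u v, G u <+: G v ↔ u <+: v)
    (u : List (Fin b)) (t : List ℕ) :
    ImmSuc (Set.range G) (G u) t ↔ ∃ a, t = G (u ++ [a]) := by
  have hinj := injective_of_prefix_iff hG
  constructor
  · rintro ⟨-, ⟨v, rfl⟩, huv, hne, h⟩
    obtain ⟨w, rfl⟩ := (hG u v).1 huv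
    cases w with
    | nil => simp at hne
    | cons a w =>
      have h₁ : G u <+: G (u ++ [a]) := (hG _ _).2 (List.prefix_append _ _)
      have h₂ : G (u ++ [a]) <+: G (u ++ a :: w) := (hG _ _).2 (by simp)
      rcases h _ ⟨_, rfl⟩ h₁ h₂ with h | h
      · have := hinj h
        simp at this
      · exact ⟨a, h.symm⟩
  · rintro ⟨a, rfl⟩
    refine ⟨⟨_, rfl⟩, ⟨_, rfl⟩, (hG _ _).2 (List.prefix_append _ _), fun h => ?_, ?_⟩
    · have := hinj h
      simp at this
    · rintro _ ⟨v, rfl⟩ h₁ h₂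
      obtain ⟨w, rfl⟩ := (hG _ _).1 h₁
      have hw : w <+: [a] := by simpa using (hG _ _).1 h₂
      rcases List.prefix_cons_iff.1 hw with rfl | ⟨w', rfl, hw'⟩
      · simp
      · obtain rfl := List.prefix_nil.1 hw'
        simp

theorem ImmSuc.mem_level_succ {S : Set (List ℕ)} {s t : List ℕ} (h : ImmSuc S s t) {n : ℕ}
    (hs : s ∈ level S n) : t ∈ level S (n + 1) := by
  obtain ⟨hsS, htS, hst, hne, himm⟩ := h
  refine ⟨htS, ?_⟩
  have : {x ∈ S | x <+: t ∧ x ≠ t} = insert s {x ∈ S | x <+: s ∧ x ≠ s} := by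
    ext x
    constructor
    · rintro ⟨hx, hxt, hxne⟩
      rcases List.prefix_or_prefix_of_prefix hxt hst with hxs | hsx
      · by_cases hxs' : x = s
        · exact Or.inl hxs'
        · exact Or.inr ⟨hx, hxs, hxs'⟩
      · exact Or.inl ((himm x hx hsx hxt).resolve_right hxne)
    · rintro (rfl | ⟨hx, hxs, hxne⟩)
      · exact ⟨hsS, hst, hne⟩
      · refine ⟨hx, hxs.trans hst, ?_⟩
        rintro rfl
        exact hxne (hxs.eq_of_length_le hst.length_le)
  rw [this, Set.ncard_insert_of_notMem (fun h => h.2.2 rfl)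
    ((finite_setOf_prefix s).subset fun x hx => hx.2.1), hs.2]

theorem exists_immSuc_of_mem_level_succ {S : Set (List ℕ)} {t : List ℕ} {n : ℕ}
    (ht : t ∈ level S (n + 1)) : ∃ s ∈ level S n, ImmSuc S s t := by
  have hfin : {x ∈ S | x <+: t ∧ x ≠ t}.Finite :=
    (finite_setOf_prefix t).subset fun x hx => hx.2.1
  have hne : {x ∈ S | x <+: t ∧ x ≠ t}.Nonempty := by
    rw [← Set.ncard_pos hfin, ht.2]
    omega
  obtain ⟨s, ⟨hsS, hst, hsne⟩, hmax⟩ := Set.exists_max_image _ List.length hfin hne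
  have himm : ImmSuc S s t := by
    refine ⟨hsS, ht.1, hst, hsne, fun u hu hsu hut => ?_⟩
    by_cases hut' : u = t
    · exact Or.inr hut'
    · exact Or.inl (hsu.eq_of_length_le (hmax u ⟨hu, hut, hut'⟩)).symm
  have hs : s ∈ level S {x ∈ S | x <+: s ∧ x ≠ s}.ncard := ⟨hsS, rfl⟩
  have := (himm.mem_level_succ hs).2.symm.trans ht.2
  exact ⟨s, by rwa [Nat.succ_injective this] at hs, himm⟩

end Levels

section StrongEmb

variable {b : ℕ} {g h : List (Fin b) → List (Fin b)} {lg l : ℕ → ℕ}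

theorem isStrongEmb_id : IsStrongEmb (id : List (Fin b) → List (Fin b)) id :=
  ⟨fun _ => rfl, fun _ _ => List.prefix_rfl⟩

theorem IsStrongEmb.prefix_of_prefix (hg : IsStrongEmb g lg) {u v : List (Fin b)}
    (huv : u <+: v) : g u <+: g v := by
  obtain ⟨w, rfl⟩ := huv
  induction w using List.reverseRecOn with
  | nil => simp
  | append_singleton w a ih =>
    rw [← List.append_assoc]
    exact ih.trans ((List.prefix_append _ _).trans (hg.append_prefix _ a))

theorem IsStrongEmb.prefix_iff (hg : IsStrongEmb g lg) (u v : List (Fin b)) :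
    g u <+: g v ↔ u <+: v := by
  refine ⟨fun huv => ?_, hg.prefix_of_prefix⟩
  induction u using List.reverseRecOn with
  | nil => simp
  | append_singleton u a ih =>
    have hua : g u ++ [a] <+: g v := (hg.append_prefix u a).trans huv
    obtain ⟨w, rfl⟩ := ih ((List.prefix_append _ _).trans hua)
    cases w with
    | nil =>
      have := hua.length_le
      simp at this
    | cons c w =>
      have huc : g u ++ [c] <+: g (u ++ c :: w) :=
        (hg.append_prefix u c).trans (hg.prefix_of_prefix (by simp))
      have heq := (List.prefix_of_prefix_length_le hua huc (by simp)).eq_of_length (by simp)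
      obtain rfl : a = c := by simpa using heq
      simp

theorem IsStrongEmb.comp (hg : IsStrongEmb g lg) (hh : IsStrongEmb h l) :
    IsStrongEmb (g ∘ h) (lg ∘ l) where
  length_eq u := by simp [hg.length_eq, hh.length_eq]
  append_prefix u a := (hg.append_prefix (h u) a).trans (hg.prefix_of_prefix (hh.append_prefix u a))

theorem IsStrongEmb.strictMono (hb : 0 < b) (hg : IsStrongEmb g lg) : StrictMono lg := by
  refine strictMono_nat_of_lt_succ fun n => ?_
  have := (hg.append_prefix (List.replicate n ⟨0, hb⟩) ⟨0, hb⟩).length_le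
  simpa [hg.length_eq] using this

/-- The node of `ℕ^{<ℕ}` indexed by `u` in the tree parametrized by `g`. -/
def node (g : List (Fin b) → List (Fin b)) (u : List (Fin b)) : List ℕ := (g u).map Fin.val

theorem bSeq_eq_range_node (b : ℕ) : bSeq b = Set.range (node (b := b) id) := by
  ext t
  constructor
  · intro (ht : ∀ x ∈ t, x < b)
    refine ⟨t.pmap (fun x hx => ⟨x, hx⟩) ht, ?_⟩
    exact List.ext_getElem (by simp [node]) (by simp [node])
  · rintro ⟨u, rfl⟩ x hx
    obtain ⟨y, -, rfl⟩ := List.mem_map.1 hx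
    exact y.2

theorem IsStrongEmb.node_prefix_iff (hg : IsStrongEmb g lg) (u v : List (Fin b)) :
    node g u <+: node g v ↔ u <+: v := by
  rw [node, node, List.prefix_map_iff_of_injective Fin.val_injective, hg.prefix_iff]

theorem IsStrongEmb.isStrongSubtreeWith (hb : 0 < b) (hg : IsStrongEmb g lg)
    (hh : IsStrongEmb h l) :
    IsStrongSubtreeWith (Set.range (node g)) (Set.range (node (g ∘ h))) l := by
  have hgh := hg.comp hh
  refine ⟨?_, ?_, hh.strictMono hb, fun n => ?_, ?_⟩
  · rintro _ ⟨u, rfl⟩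
    exact ⟨h u, rfl⟩
  · refine ⟨node (g ∘ h) [], ?_, fun y hy => ?_⟩
    · rw [level_range hgh.node_prefix_iff]
      exact ⟨[], rfl, rfl⟩
    · rw [level_range hgh.node_prefix_iff] at hy
      obtain ⟨u, hu, rfl⟩ := hy
      rw [List.length_eq_zero_iff.1 hu]
  · rw [level_range hgh.node_prefix_iff, level_range hg.node_prefix_iff]
    rintro _ ⟨u, rfl, rfl⟩
    exact ⟨h u, hh.length_eq u, rfl⟩
  · rintro _ ⟨u, rfl⟩ t ht
    obtain ⟨a, rfl⟩ := (immSuc_range_iff hg.node_prefix_iff (h u) t).1 ht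
    refine ⟨node (g ∘ h) (u ++ [a]), ⟨(immSuc_range_iff hgh.node_prefix_iff _ _).2 ⟨a, rfl⟩,
      (hg.node_prefix_iff _ (h (u ++ [a]))).2 (hh.append_prefix u a)⟩, ?_⟩
    rintro y ⟨hy, hpre⟩
    obtain ⟨c, rfl⟩ := (immSuc_range_iff hgh.node_prefix_iff _ _).1 hy
    have hac := (hg.node_prefix_iff _ (h (u ++ [c]))).1 hpre
    have heq := (List.prefix_of_prefix_length_le hac (hh.append_prefix u c)
      (by simp)).eq_of_length (by simp)
    obtain rfl : a = c := by simpa using heq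
    rfl

theorem IsStrongEmb.exists_of_isStrongSubtreeWith (hg : IsStrongEmb g lg) {S : Set (List ℕ)}
    (hS : IsStrongSubtreeWith (Set.range (node g)) S l) :
    ∃ h, IsStrongEmb h l ∧ S = Set.range (node (g ∘ h)) := by
  obtain ⟨hsub, ⟨r, hr, hr_unique⟩, -, hlevel, hsuc⟩ := hS
  obtain ⟨x₀, rfl⟩ := hsub hr.1
  have hstep : ∀ x a, ∃ x', node g x ∈ S →
      ImmSuc S (node g x) (node g x') ∧ x ++ [a] <+: x' := by
    intro x a
    by_cases hx : node g x ∈ S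
    · obtain ⟨s', ⟨hs', hpre⟩, -⟩ := hsuc _ hx (node g (x ++ [a]))
        ((immSuc_range_iff hg.node_prefix_iff x _).2 ⟨a, rfl⟩)
      obtain ⟨x', rfl⟩ := hsub hs'.2.1
      exact ⟨x', fun _ => ⟨hs', (hg.node_prefix_iff _ _).1 hpre⟩⟩
    · exact ⟨[], fun h => (hx h).elim⟩
  choose step hstep using hstep
  let h : List (Fin b) → List (Fin b) := fun u => u.foldl step x₀
  have hconcat : ∀ u a, h (u ++ [a]) = step (h u) a := fun u a => by simp [h]
  have hmem : ∀ u, node g (h u) ∈ level S u.length := by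
    intro u
    induction u using List.reverseRecOn with
    | nil => exact hr
    | append_singleton u a ih =>
      rw [hconcat, List.length_append]
      exact (hstep (h u) a ih.1).1.mem_level_succ ih
  refine ⟨h, ⟨fun u => ?_, fun u a => ?_⟩, Set.Subset.antisymm ?_ ?_⟩
  · have := hlevel _ (hmem u)
    rw [level_range hg.node_prefix_iff] at this
    obtain ⟨v, hv, hvu⟩ := this
    rw [← injective_of_prefix_iff hg.node_prefix_iff hvu]
    exact hv
  · rw [hconcat]
    exact (hstep (h u) a (hmem u).1).2
  · have hsurj : ∀ n, ∀ s ∈ level S n, s ∈ Set.range (node (g ∘ h)) := by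
      intro n
      induction n with
      | zero =>
        intro s hs
        exact ⟨[], (hr_unique s hs).symm⟩
      | succ n ih =>
        intro s hs
        obtain ⟨s₀, hs₀, himm⟩ := exists_immSuc_of_mem_level_succ hs
        obtain ⟨u, rfl⟩ := ih s₀ hs₀
        obtain ⟨y, rfl⟩ := hsub hs.1
        obtain ⟨w, rfl⟩ := (hg.node_prefix_iff (h u) y).1 himm.2.2.1
        cases w with
        | nil => exact (himm.2.2.2.1 (by simp [node])).elim
        | cons a w =>
          have hua := hstep (h u) a (hmem u).1
          rw [← hconcat] at hua
          exact ⟨u ++ [a], (hsuc _ hs₀.1 (node g (h u ++ [a]))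
            ((immSuc_range_iff hg.node_prefix_iff (h u) _).2 ⟨a, rfl⟩)).unique
            ⟨hua.1, (hg.node_prefix_iff _ (h (u ++ [a]))).2 hua.2⟩
            ⟨himm, (hg.node_prefix_iff _ _).2 (by simp)⟩⟩
    exact fun s hs => hsurj _ s ⟨hs, rfl⟩
  · rintro _ ⟨u, rfl⟩
    exact (hmem u).1

end StrongEmb

/-- Strong embeddings above the immediate successors of the root, glued together over the root. -/
def consEmb {b : ℕ} (η : Fin b → List (Fin b) → List (Fin b)) : List (Fin b) → List (Fin b)
  | [] => []
  | a :: v => a :: η a v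

/-- The level function of `consEmb`. -/
def consLevel (l : ℕ → ℕ) : ℕ → ℕ
  | 0 => 0
  | n + 1 => l n + 1

theorem isStrongEmb_consEmb {b : ℕ} {η : Fin b → List (Fin b) → List (Fin b)} {l : ℕ → ℕ}
    (hη : ∀ a, IsStrongEmb (η a) l) : IsStrongEmb (consEmb η) (consLevel l) where
  length_eq u := by cases u <;> simp [consEmb, consLevel, (hη _).length_eq]
  append_prefix u a := by
    cases u with
    | nil => simp [consEmb]
    | cons c v => simpa [consEmb] using (hη c).append_prefix v a

section Fans

variable {d : ℕ} {b : Fin d → ℕ}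

/-- The vector fan with the same root as the vector tree parametrized by `ρ`, with a node
`a :: f ⟨i, a⟩` above each immediate successor `a` of the root in the `i`-th tree. -/
def fanOf (ρ : ∀ i, List (Fin (b i)) → List (Fin (b i)))
    (f : ∀ k : (i : Fin d) × Fin (b i), List (Fin (b k.1))) : Fin d → Set (List ℕ) :=
  fun i => insert (node (ρ i) []) (Set.range fun a => node (ρ i) (a :: f ⟨i, a⟩))

theorem exists_eq_fanOf {σ : ∀ i, List (Fin (b i)) → List (Fin (b i))} {ls : Fin d → ℕ → ℕ}
    (hσ : ∀ i, IsStrongEmb (σ i) (ls i)) {F : Fin d → Set (List ℕ)}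
    (hF : IsVecFan (fun i => Set.range (node (σ i))) F)
    (hF₀ : ∀ i, level (F i) 0 = {node (σ i) []}) :
    ∃ (m : ℕ) (v : ∀ k : (i : Fin d) × Fin (b i), List (Fin (b k.1))),
      (∀ k, (v k).length = m) ∧ F = fanOf σ v ∧
        ∀ i a, node (σ i) (a :: v ⟨i, a⟩) ∈ level (F i) 1 := by
  obtain ⟨R, ⟨l, hR⟩, hFR⟩ := hF
  choose h hh hRh using fun i => (hσ i).exists_of_isStrongSubtreeWith (hR i)
  have hpre := fun i => ((hσ i).comp (hh i)).node_prefix_iff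
  have hFi : ∀ i, F i = node (σ i ∘ h i) '' {u | u.length ≤ 1} := by
    intro i
    rw [hFR, hRh, level_range (hpre i), level_range (hpre i), ← Set.image_union]
    congr 1
    ext u
    simp only [Set.mem_union, Set.mem_ofPred_eq]
    omega
  have hlevel : ∀ i n, level (F i) n = node (σ i ∘ h i) '' {u | u.length ≤ 1 ∧ u.length = n} := by
    intro i n
    rw [hFi]
    exact level_image (hpre i) (D := {u | u.length ≤ 1}) (fun u hu v hv => hv.length_le.trans hu) n
  have hroot : ∀ i, h i [] = [] := by
    intro i
    have hmem : node (σ i ∘ h i) [] ∈ level (F i) 0 := by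
      rw [hlevel]
      exact ⟨[], ⟨by simp, rfl⟩, rfl⟩
    rw [hF₀, Set.mem_singleton_iff] at hmem
    exact injective_of_prefix_iff (hσ i).node_prefix_iff hmem
  have hcons : ∀ i a, h i [a] = a :: (h i [a]).tail := by
    intro i a
    obtain ⟨w, hw⟩ := (hh i).append_prefix [] a
    rw [hroot] at hw
    simp only [List.nil_append, List.singleton_append] at hw
    rw [← hw]
    rfl
  refine ⟨l 1 - 1, fun k => (h k.1 [k.2]).tail, fun k => ?_, ?_, fun i a => ?_⟩
  · simp [(hh k.1).length_eq]
  · funext i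
    rw [hFi, fanOf]
    ext s
    simp only [← hcons, Set.mem_image, Set.mem_insert_iff, Set.mem_range, Set.mem_ofPred_eq]
    constructor
    · rintro ⟨u, hu, rfl⟩
      match u, hu with
      | [], _ => exact Or.inl (by simp [node, hroot])
      | [a], _ => exact Or.inr ⟨a, rfl⟩
    · rintro (rfl | ⟨a, rfl⟩)
      · exact ⟨[], by simp, by simp [node, hroot]⟩
      · exact ⟨[a], by simp, rfl⟩
  · rw [hlevel, ← hcons]
    exact ⟨[a], ⟨by simp, by simp⟩, rfl⟩

theorem IsVecHomogeneous.exists_isStrongEmb {T : Fin d → Set (List ℕ)}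
    (hT : IsVecHomogeneous b T) :
    ∃ (τ : ∀ i, List (Fin (b i)) → List (Fin (b i))) (lT : Fin d → ℕ → ℕ),
      (∀ i, IsStrongEmb (τ i) (lT i)) ∧ T = fun i => Set.range (node (τ i)) := by
  choose lT hT using fun i => (hT i).2
  choose τ hτ hTτ using fun i => isStrongEmb_id.exists_of_isStrongSubtreeWith
    (bSeq_eq_range_node (b i) ▸ hT i)
  exact ⟨τ, lT, hτ, funext hTτ⟩

end Fans

/-- stabilizing a family of dense sets of vector fans. -/
theorem fan_stabilization (d : ℕ) (b : Fin d → ℕ) (T : Fin d → Set (List ℕ))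
    (hT : IsVecHomogeneous b T)
    (𝔽 : ℕ → Set (Fin d → Set (List ℕ)))
    (h𝔽 : ∀ n, 1 ≤ n → ∀ S : Fin d → Set (List ℕ), IsVecStrongSubtree T S →
      ∃ F ∈ 𝔽 n, IsVecFan S F ∧ ∀ i, level (F i) 0 = level (S i) 0) :
    ∀ R : Fin d → Set (List ℕ), IsVecStrongSubtree T R →
      ∀ r0 : Fin d → List ℕ, IsRoot R r0 →
        ∃ Z : Fin d → Set (List ℕ), IsVecStrongSubtree R Z ∧ IsRoot Z r0 ∧
          ∀ n, 1 ≤ n → ∀ F ∈ fanAt Z n, IsRoot F r0 → F ∈ 𝔽 n := by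
  intro R hR r0 hr0
  have hb : ∀ i, 0 < b i := fun i => two_pos.trans_le (hT i).1
  obtain ⟨τ, lT, hτ, rfl⟩ := hT.exists_isStrongEmb
  obtain ⟨lR, hR⟩ := hR
  choose r hr hRr using fun i => (hτ i).exists_of_isStrongSubtreeWith (hR i)
  obtain rfl : R = fun i => Set.range (node (τ i ∘ r i)) := funext hRr
  let ρ : ∀ i, List (Fin (b i)) → List (Fin (b i)) := fun i => τ i ∘ r i
  have hρ : ∀ i, IsStrongEmb (ρ i) (lT i ∘ lR) := fun i => (hτ i).comp (hr i)
  have hroot : ∀ {σ : ∀ i, List (Fin (b i)) → List (Fin (b i))} {ls : Fin d → ℕ → ℕ},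
      (∀ i, IsStrongEmb (σ i) (ls i)) → ∀ i,
        level (Set.range (node (σ i))) 0 = {node (σ i) []} := by
    intro σ ls hσ i
    simp [level_range (hσ i).node_prefix_iff]
  have hr0' : ∀ i, r0 i = node (ρ i) [] := fun i =>
    Set.singleton_injective ((hr0 i).symm.trans (hroot hρ i))
  -- Above each immediate successor of the root we have one tree of the product to be refined.
  obtain ⟨η, l, hη, hη𝔽⟩ := exists_isStrongEmb_mem
    (fun k : (i : Fin d) × Fin (b i) => b k.1) (fun k => hb k.1)
    (fun n => {f | fanOf ρ f ∈ 𝔽 (n + 1)}) (by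
      intro n η l hη
      have hc : ∀ i, IsStrongEmb (consEmb fun a => η ⟨i, a⟩) (consLevel l) :=
        fun i => isStrongEmb_consEmb fun a => hη ⟨i, a⟩
      have hσ := fun i => (hρ i).comp (hc i)
      obtain ⟨F, hF𝔽, hF, hF₀⟩ := h𝔽 (n + 1) (by omega) _
        ⟨lR ∘ consLevel l, fun i => (hτ i).isStrongSubtreeWith (hb i) ((hr i).comp (hc i))⟩
      obtain ⟨m, v, hvm, rfl, -⟩ := exists_eq_fanOf hσ hF fun i => (hF₀ i).trans (hroot hσ i)
      exact ⟨m, v, hvm, hF𝔽⟩)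
  have hc : ∀ i, IsStrongEmb (consEmb fun a => η ⟨i, a⟩) (consLevel l) :=
    fun i => isStrongEmb_consEmb fun a => hη ⟨i, a⟩
  have hσ := fun i => (hρ i).comp (hc i)
  refine ⟨fun i => Set.range (node (ρ i ∘ consEmb fun a => η ⟨i, a⟩)),
    ⟨consLevel l, fun i => (hρ i).isStrongSubtreeWith (hb i) (hc i)⟩,
    fun i => (hroot hσ i).trans (by rw [hr0']; rfl), fun n hn F hF hFr => ?_⟩
  obtain ⟨m, v, hvm, rfl, hv⟩ := exists_eq_fanOf hσ hF.1
    fun i => (hFr i).trans (by rw [hr0']; rfl)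
  obtain ⟨n, rfl⟩ : ∃ n', n = n' + 1 := ⟨n - 1, by omega⟩
  refine hη𝔽 n v fun k => ?_
  have hlev := hF.2 (fun i => hv i ⟨0, hb i⟩) k.1
  rw [level_range (hσ k.1).node_prefix_iff] at hlev
  obtain ⟨u, hu, hu'⟩ := hlev
  rw [injective_of_prefix_iff (hσ k.1).node_prefix_iff hu'] at hu
  have hlen : (v ⟨k.1, ⟨0, hb k.1⟩⟩).length + 1 = n + 1 := hu
  rw [hvm] at hlen ⊢
  omega
end DHLPaper
end
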